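/- arXiv:2006.02003 — 2 statements merged into one kernel-verified Lean document; each statement's English description precedes it below -/
import Mathlib

section
/- Let X be a finite nonempty type and p_data a probability mass function on X with p_data(x) > 0 for all x. For every finite nonempty latent type Z, the supremum, over all joint probability mass functions p on X × Z with p(x,z) > 0 and over all families of conditional probability mass functions q(·|x) on Z with q(z|x) > 0, of the expected ELBO ∑_x p_data(x) ∑_z q(z|x) · log(p(x,z)/q(z|x)) equals ∑_x p_data(x) · log p_data(x). In particular this supremum is attained and is constant with respect to the cardinality of Z. -/
/-- Gibbs' inequality for positive, not necessarily normalized, weights on a finite type. -/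
theorem sum_mul_log_div_le_sub {ι : Type*} [Fintype ι] (a b : ι → ℝ)
    (ha : ∀ i, 0 < a i) (hb : ∀ i, 0 < b i) :
    ∑ i, a i * Real.log (b i / a i) ≤ ∑ i, b i - ∑ i, a i := by
  rw [← Finset.sum_sub_distrib]
  refine Finset.sum_le_sum fun i _ => ?_
  calc a i * Real.log (b i / a i) ≤ a i * (b i / a i - 1) :=
        mul_le_mul_of_nonneg_left (Real.log_le_sub_one_of_pos (div_pos (hb i) (ha i))) (ha i).le
    _ = b i - a i := by have := (ha i).ne'; field_simp

/-- The expected ELBO is the negative entropy of the data distribution minus the Kullback-Leibler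
divergence from the joint law `w x * q x z` to the model `p`. -/
theorem expected_elbo_eq_add {X Z : Type*} [Fintype X] [Fintype Z]
    (w : X → ℝ) (p : X × Z → ℝ) (q : X → Z → ℝ) (hw : ∀ x, 0 < w x) (hp : ∀ xz, 0 < p xz)
    (hq : ∀ x z, 0 < q x z) (hq_sum : ∀ x, ∑ z, q x z = 1) :
    ∑ x, w x * ∑ z, q x z * Real.log (p (x, z) / q x z) =
      ∑ x, w x * Real.log (w x) +
        ∑ xz : X × Z, w xz.1 * q xz.1 xz.2 * Real.log (p xz / (w xz.1 * q xz.1 xz.2)) := by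
  rw [Fintype.sum_prod_type, ← Finset.sum_add_distrib]
  refine Finset.sum_congr rfl fun x _ => ?_
  have hlog (z : Z) : Real.log (p (x, z) / q x z) =
      Real.log (w x) + Real.log (p (x, z) / (w x * q x z)) := by
    have := (hw x).ne'
    have := (hq x z).ne'
    rw [← Real.log_mul (hw x).ne' (div_pos (hp _) (mul_pos (hw x) (hq x z))).ne']
    congr 1
    field_simp
  simp only [hlog, mul_add, Finset.sum_add_distrib, ← Finset.sum_mul, hq_sum, one_mul,
    Finset.mul_sum, mul_assoc]

/-- For every finite nonempty latent type `Z`, the supremum of the expected ELBO over all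
positive joint pmfs `p` on `X × Z` and families of positive conditional pmfs `q (· | x)` on `Z`
is attained and equals `∑ x, pdata x * log (pdata x)`; in particular it is constant with
respect to the cardinality of `Z`. -/
theorem expected_elbo_isGreatest {X : Type*} [Fintype X] [Nonempty X]
    (pdata : X → ℝ) (hpdata_pos : ∀ x, 0 < pdata x) (hpdata_sum : ∑ x, pdata x = 1)
    (Z : Type) [Fintype Z] [Nonempty Z] :
    IsGreatest
      {L : ℝ | ∃ (p : X × Z → ℝ) (q : X → Z → ℝ),
        (∀ xz, 0 < p xz) ∧ (∑ xz, p xz = 1) ∧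
        (∀ x z, 0 < q x z) ∧ (∀ x, ∑ z, q x z = 1) ∧
        L = ∑ x, pdata x * ∑ z, q x z * Real.log (p (x, z) / q x z)}
      (∑ x, pdata x * Real.log (pdata x)) := by
  constructor
  · have hcard : (0 : ℝ) < Fintype.card Z := by exact_mod_cast Fintype.card_pos
    have hq : ∀ (_ : X) (_ : Z), (0 : ℝ) < (Fintype.card Z : ℝ)⁻¹ := fun _ _ => inv_pos.2 hcard
    have hq_sum : ∀ _ : X, ∑ _ : Z, (Fintype.card Z : ℝ)⁻¹ = 1 := fun _ => by
      simp [hcard.ne']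
    have hp (xz : X × Z) : 0 < pdata xz.1 * (Fintype.card Z : ℝ)⁻¹ :=
      mul_pos (hpdata_pos _) (inv_pos.2 hcard)
    refine ⟨fun xz => pdata xz.1 * (Fintype.card Z : ℝ)⁻¹, fun _ _ => (Fintype.card Z : ℝ)⁻¹,
      hp, ?_, hq, hq_sum, ?_⟩
    · simp_rw [Fintype.sum_prod_type, ← Finset.mul_sum]
      rw [← Finset.sum_mul, hpdata_sum, one_mul]
      simp [hcard.ne']
    · rw [expected_elbo_eq_add pdata _ _ hpdata_pos hp hq hq_sum]
      simp [div_self (hp _).ne']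
  · rintro L ⟨p, q, hp, hp_sum, hq, hq_sum, rfl⟩
    rw [expected_elbo_eq_add pdata p q hpdata_pos hp hq hq_sum]
    have hjoint : ∑ xz : X × Z, pdata xz.1 * q xz.1 xz.2 = 1 := by
      simp [Fintype.sum_prod_type, ← Finset.mul_sum, hq_sum, hpdata_sum]
    have hgibbs := sum_mul_log_div_le_sub (fun xz : X × Z => pdata xz.1 * q xz.1 xz.2) p
      (fun xz => mul_pos (hpdata_pos _) (hq _ _)) hp
    linarith
end

section
/- Let K ≥ 1 and for each j ∈ Fin K let μ_j ∈ ℝ^n and σ_j ∈ ℝ^n with all components of σ_j positive, and let f_j = g_{μ_j, σ_j} be the corresponding diagonal-covariance Gaussian density. If for every index i and every z ∈ ℝ^n one has f_i(z) / (∑_j f_j(z)) = 1/K, then the mixture components collapse: μ_i = μ_j and σ_i = σ_j for all indices i, j. -/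
/-- The diagonal-covariance Gaussian density on `ℝ^n` with mean `μ` and componentwise
standard deviations `σ`. -/
noncomputable def diagGaussian {n : ℕ} (μ σ : Fin n → ℝ) (z : Fin n → ℝ) : ℝ :=
  ∏ i, (2 * Real.pi * (σ i) ^ 2) ^ (-(1 / 2) : ℝ) *
    Real.exp (-(z i - μ i) ^ 2 / (2 * (σ i) ^ 2))

lemma diagGaussian_pos {n : ℕ} (μ σ : Fin n → ℝ) (hσ : ∀ i, 0 < σ i) (z : Fin n → ℝ) :
    0 < diagGaussian μ σ z := by
  unfold diagGaussian
  refine Finset.prod_pos fun i _ => ?_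
  have := hσ i
  positivity

/-- Along a coordinate line, the log-density is a constant minus the one-dimensional quadratic. -/
lemma exists_log_diagGaussian_update {n : ℕ} (μ σ : Fin n → ℝ) (hσ : ∀ i, 0 < σ i)
    (z : Fin n → ℝ) (k : Fin n) :
    ∃ c : ℝ, ∀ t : ℝ, Real.log (diagGaussian μ σ (Function.update z k t)) =
      c - (1 / (2 * (σ k) ^ 2)) * (t - μ k) ^ 2 := by
  refine ⟨∑ i, Real.log ((2 * Real.pi * (σ i) ^ 2) ^ (-(1 / 2) : ℝ)) +
    ∑ i ∈ Finset.univ.erase k, -(z i - μ i) ^ 2 / (2 * (σ i) ^ 2), fun t => ?_⟩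
  have hpos (i : Fin n) : (0 : ℝ) < (2 * Real.pi * (σ i) ^ 2) ^ (-(1 / 2) : ℝ) := by
    have := hσ i
    positivity
  unfold diagGaussian
  rw [Real.log_prod fun i _ => (mul_pos (hpos i) (Real.exp_pos _)).ne']
  simp_rw [Real.log_mul (hpos _).ne' (Real.exp_pos _).ne', Real.log_exp]
  have herase : ∑ i ∈ Finset.univ.erase k,
      -(Function.update z k t i - μ i) ^ 2 / (2 * (σ i) ^ 2) =
      ∑ i ∈ Finset.univ.erase k, -(z i - μ i) ^ 2 / (2 * (σ i) ^ 2) :=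
    Finset.sum_congr rfl fun i hi => by
      rw [Function.update_of_ne (Finset.ne_of_mem_erase hi)]
  rw [Finset.sum_add_distrib, ← Finset.add_sum_erase Finset.univ
    (fun i => -(Function.update z k t i - μ i) ^ 2 / (2 * (σ i) ^ 2)) (Finset.mem_univ k),
    herase, Function.update_self]
  ring

lemma diagGaussian_injective {n : ℕ} {μ σ μ' σ' : Fin n → ℝ} (hσ : ∀ i, 0 < σ i)
    (hσ' : ∀ i, 0 < σ' i) (h : ∀ z, diagGaussian μ σ z = diagGaussian μ' σ' z) :
    μ = μ' ∧ σ = σ' := by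
  have key (k : Fin n) : μ k = μ' k ∧ σ k = σ' k := by
    obtain ⟨c, hc⟩ := exists_log_diagGaussian_update μ σ hσ 0 k
    obtain ⟨c', hc'⟩ := exists_log_diagGaussian_update μ' σ' hσ' 0 k
    have heq (t : ℝ) := (hc t).symm.trans ((congrArg Real.log (h _)).trans (hc' t))
    have h₀ := heq 0
    have h₁ := heq 1
    have h₂ := heq (-1)
    have hs := hσ k
    have hs' := hσ' k
    have hprec : 1 / (2 * (σ k) ^ 2) = 1 / (2 * (σ' k) ^ 2) := by linarith
    have hvar : (σ k) ^ 2 = (σ' k) ^ 2 := by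
      have := inv_injective (by simpa only [one_div] using hprec)
      linarith
    refine ⟨?_, (pow_left_inj₀ hs.le hs'.le two_ne_zero).1 hvar⟩
    rw [← hprec] at h₁ h₂
    have hne : 1 / (2 * (σ k) ^ 2) ≠ 0 := by positivity
    exact mul_left_cancel₀ hne (by linarith)
  exact ⟨funext fun k => (key k).1, funext fun k => (key k).2⟩

/-- Mode collapse for a Gaussian mixture: if the responsibilities of the Gaussian components
under a uniform prior are uniform everywhere, then all subcluster means and standard
deviations coincide. -/
theorem gaussian_mixture_collapse {n K : ℕ} (hK : 1 ≤ K)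
    (μ σ : Fin K → Fin n → ℝ) (hσ : ∀ j i, 0 < σ j i)
    (hunif : ∀ (i : Fin K) (z : Fin n → ℝ),
      diagGaussian (μ i) (σ i) z / (∑ j, diagGaussian (μ j) (σ j) z) = 1 / K) :
    ∀ i j : Fin K, μ i = μ j ∧ σ i = σ j := by
  intro i j
  refine diagGaussian_injective (hσ i) (hσ j) fun z => ?_
  have hsum : (∑ l, diagGaussian (μ l) (σ l) z) ≠ 0 :=
    (Finset.sum_pos (fun l _ => diagGaussian_pos _ _ (hσ l) z) ⟨i, Finset.mem_univ i⟩).ne'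
  exact (div_left_inj' hsum).1 ((hunif i z).trans (hunif j z).symm)
end
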